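/- If H is an effectively 0D spin Hamiltonian, then its language with binary energy encoding L_H^b is a regular language. -/

import Mathlib

/-- The finite alphabet of the language: Σ_q ∪ [p] ∪ auxiliary symbols. -/
inductive Symb (q p : ℕ) : Type where
  | spin (s : Fin q)      -- a spin symbol from Σ_q
  | ham (α : Fin p)       -- a local-Hamiltonian label from [p]
  | lhd                   -- ◁
  | rhd                   -- ▷
  | sq                    -- □
  | dia                   -- ◇
  | tri                   -- ▲
  | blank                 -- ␣
  | comp                  -- ∘
  | bullet                -- •
  | plus                  -- +
  | minus                 -- −
  | zero                  -- 0
  | one                   -- 1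
  deriving DecidableEq, Fintype

/-- A local interaction `I = (α, A)`: a label `α ∈ [p]` together with a tuple of `k`
addresses, each an integer or the missing-spin symbol ▲ (modelled as `none`). -/
abbrev LocInt (k p : ℕ) := Fin p × (Fin k → Option ℤ)

/-- A configuration `(s_1, I_1, …, s_n, I_n)` (positions are 0-based here). -/
abbrev Config (q k p : ℕ) := List (Fin q × LocInt k p)

/-- The spin addressed by address `a` relative to (0-based) position `j`:
it is `▲` (`none`) whenever `a = ▲` or the addressed position lies outside `[n]`. -/
def spinAt {q k p : ℕ} (x : Config q k p) (j : ℕ) : Option ℤ → Option (Fin q)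
  | none => none
  | some l =>
      if 0 ≤ (j : ℤ) + l then (x[((j : ℤ) + l).toNat]?).map Prod.fst else none

/-- `H(s_1,I_1,…,s_n,I_n) = Σ_{j=1}^n h_{α_j}((s_{j+l})_{l ∈ A_j})`. -/
def energy {q k p : ℕ} (h : Fin p → (Fin k → Option (Fin q)) → ℤ)
    (x : Config q k p) : ℤ :=
  ∑ j : Fin x.length, h (x.get j).2.1 (fun l => spinAt x (j : ℕ) ((x.get j).2.2 l))

/-- The unary encoding `u : ℤ → {◇,□}*`. -/
def unary {q p : ℕ} (z : ℤ) : List (Symb q p) :=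
  if 0 ≤ z then List.replicate z.toNat Symb.dia else List.replicate (-z).toNat Symb.sq

/-- Encoding of an address: `u(a)` for an integer `a`, and `▲` for the missing-spin symbol. -/
def encAddr {q p : ℕ} : Option ℤ → List (Symb q p)
  | none => [Symb.tri]
  | some z => unary z

/-- `γ(α, (a_1,…,a_k)) = α ◁ u(a_1) ␣ ⋯ ␣ u(a_k) ▷`. -/
def encInt {q k p : ℕ} (I : LocInt k p) : List (Symb q p) :=
  [Symb.ham I.1, Symb.lhd] ++
    List.intercalate [Symb.blank] (List.ofFn fun l => encAddr (I.2 l)) ++ [Symb.rhd]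

/-- `e(s_1,I_1,…,s_n,I_n) = s_1 γ(I_1) ⋯ s_n γ(I_n)`. -/
def encConfig {q k p : ℕ} (x : Config q k p) : List (Symb q p) :=
  (x.map fun si => Symb.spin si.1 :: encInt si.2).flatten

/-- `𝓘_{1D} ⊆ [p] × {−k,…,k}^k` and nonempty: each address is an integer in `{−k,…,k}`. -/
def Is1DIntSet {k p : ℕ} (S : Set (LocInt k p)) : Prop :=
  S.Nonempty ∧ ∀ I ∈ S, ∀ l : Fin k, ∃ a : ℤ, I.2 l = some a ∧ -(k : ℤ) ≤ a ∧ a ≤ k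

/-- The domain of a 1D spin Hamiltonian with constant interaction set `S = 𝓘_{1D}`:
all configurations of any length `n ≥ 1` with all local interactions drawn from `S`. -/
def Domain1D {k p : ℕ} (q : ℕ) (S : Set (LocInt k p)) : Set (Config q k p) :=
  {x | x ≠ [] ∧ ∀ j : Fin x.length, (x.get j).2 ∈ S}

/-- The binary encoding `b : ℤ → {+,−} × {0,1}*`: a sign symbol followed by the binary
digits `c_1 ⋯ c_m` of `|n|` (least significant first, `|n| = Σ_l c_l 2^{l−1}`). -/
def binEnc {q p : ℕ} (z : ℤ) : List (Symb q p) :=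
  (if 0 ≤ z then Symb.plus else Symb.minus) ::
    (z.natAbs.bits.map fun b => if b then Symb.one else Symb.zero)

/-- The language of `H` with binary energy encoding, `L_H^b = { e(x) ∘ b(H(x)) • : x ∈ 𝒟 }`. -/
def langHB {q k p : ℕ} (h : Fin p → (Fin k → Option (Fin q)) → ℤ)
    (D : Set (Config q k p)) : Language (Symb q p) :=
  {w | ∃ x ∈ D, w = encConfig x ++ [Symb.comp] ++ binEnc (energy h x) ++ [Symb.bullet]}

theorem List.exists_append_of_prefix_flatMap_append {α σ : Type*} (φ : α → List σ)
    {t : List σ} {x : List α} {w : List σ} (h : w <+: x.flatMap φ ++ t) :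
    ∃ y z r, x = y ++ z ∧ w = y.flatMap φ ++ r ∧ (r <+: t ∨ ∃ a ∈ x, r <+: φ a) := by
  induction x generalizing w with
  | nil => exact ⟨[], [], w, rfl, rfl, Or.inl (by simpa using h)⟩
  | cons a x ih =>
    obtain ⟨v, h⟩ := h
    rw [List.flatMap_cons, List.append_assoc] at h
    rcases List.append_eq_append_iff.1 h with ⟨s, hs, -⟩ | ⟨w', rfl, hw⟩
    · exact ⟨[], a :: x, w, rfl, rfl, Or.inr ⟨a, by simp, s, hs.symm⟩⟩
    · obtain ⟨y, z, r, rfl, rfl, hr⟩ := ih ⟨v, hw.symm⟩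
      refine ⟨a :: y, z, r, rfl, by simp, hr.imp_right ?_⟩
      rintro ⟨b, hb, hr⟩
      exact ⟨b, List.mem_cons_of_mem _ hb, hr⟩

theorem List.finite_setOf_prefix {σ : Type*} {T : Set (List σ)} (hT : T.Finite) :
    {r | ∃ t ∈ T, r <+: t}.Finite := by
  have : {r | ∃ t ∈ T, r <+: t} = ⋃ t ∈ T, {r | r ∈ t.inits} := by
    ext r; simp
  rw [this]
  exact hT.biUnion fun t _ => List.finite_toSet t.inits

theorem List.finite_setOf_forall_mem_length_le {α : Type*} {A : Set α} (hA : A.Finite) (n : ℕ) :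
    {x : List α | (∀ a ∈ x, a ∈ A) ∧ x.length ≤ n}.Finite := by
  have := hA.to_subtype
  refine ((List.finite_length_le A n).image (List.map Subtype.val)).subset ?_
  rintro x ⟨hx, hn⟩
  lift x to List A using hx
  exact ⟨x, by simpa using hn, rfl⟩

/-- A language of block-encoded words `x`, each followed by a tail `τ x`, is regular as soon as
there are finitely many blocks and tails and a right congruence of finite index on the
unencoded words respects both membership and tails. -/
theorem Language.isRegular_flatMap_append {α σ γ : Type*} (φ : α → List σ) {A : Set α}
    (hA : A.Finite) (D : Set (List α)) (hD : ∀ x ∈ D, ∀ a ∈ x, a ∈ A) (τ : List α → List σ)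
    (hτ : (τ '' D).Finite) (c : List α → γ) (hc : (c '' {y | ∀ a ∈ y, a ∈ A}).Finite)
    (hcong : ∀ y y' z, (∀ a ∈ y, a ∈ A) → (∀ a ∈ y', a ∈ A) → c y = c y' →
      y ++ z ∈ D → y' ++ z ∈ D ∧ τ (y' ++ z) = τ (y ++ z)) :
    Language.IsRegular ({w | ∃ x ∈ D, w = x.flatMap φ ++ τ x} : Language σ) := by
  set L : Language σ := {w | ∃ x ∈ D, w = x.flatMap φ ++ τ x}
  set R : Set (List σ) := {r | ∃ t ∈ τ '' D ∪ φ '' A, r <+: t}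
  have hR : R.Finite := List.finite_setOf_prefix (hτ.union (hA.image φ))
  let T : List σ → Set (γ × List σ) := fun w =>
    {s | s.2 ∈ R ∧ ∃ y : List α, (∀ a ∈ y, a ∈ A) ∧ c y = s.1 ∧ w = y.flatMap φ ++ s.2}
  let K : γ × List σ → Language σ := fun s =>
    {v | ∃ y z, (∀ a ∈ y, a ∈ A) ∧ c y = s.1 ∧ y ++ z ∈ D ∧
      s.2 ++ v = z.flatMap φ ++ τ (y ++ z)}
  have hT : (Set.range T).Finite := by
    refine (hc.prod hR).finite_subsets.subset ?_
    rintro _ ⟨w, rfl⟩ s ⟨hs, y, hy, hcy, -⟩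
    exact ⟨⟨y, hy, hcy⟩, hs⟩
  have hquot : ∀ w, L.leftQuotient w = {v | ∃ s ∈ T w, v ∈ K s} := by
    intro w
    ext v
    rw [Language.mem_leftQuotient]
    constructor
    · rintro ⟨x, hx, hw⟩
      obtain ⟨y, z, r, rfl, rfl, hr⟩ :=
        List.exists_append_of_prefix_flatMap_append φ (t := τ x) (x := x) ⟨v, hw⟩
      have hy : ∀ a ∈ y, a ∈ A := fun a ha => hD _ hx a (List.mem_append_left _ ha)
      refine ⟨(c y, r), ⟨?_, y, hy, rfl, rfl⟩, y, z, hy, rfl, hx, ?_⟩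
      · rcases hr with hr | ⟨a, ha, hr⟩
        · exact ⟨_, Or.inl ⟨_, hx, rfl⟩, hr⟩
        · exact ⟨_, Or.inr ⟨a, hD _ hx a ha, rfl⟩, hr⟩
      · simpa using hw
    · rintro ⟨s, ⟨-, y, hy, hcy, rfl⟩, y', z, hy', hcy', hD', hv⟩
      obtain ⟨h1, h2⟩ := hcong y' y z hy' hy (hcy'.trans hcy.symm) hD'
      exact ⟨y ++ z, h1, by rw [List.append_assoc, hv, h2]; simp⟩
  apply Language.IsRegular.of_finite_range_leftQuotient
  refine (hT.image fun U => ({v | ∃ s ∈ U, v ∈ K s} : Language σ)).subset ?_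
  rintro _ ⟨w, rfl⟩
  exact ⟨T w, ⟨w, rfl⟩, (hquot w).symm⟩

section Energy

variable {q k p : ℕ}

/-- The contribution of position `j` to the energy of `x`, zero beyond the end of `x`. -/
def siteEnergy (h : Fin p → (Fin k → Option (Fin q)) → ℤ) (x : Config q k p) (j : ℕ) : ℤ :=
  (x[j]?).elim 0 fun a => h a.2.1 fun l => spinAt x j (a.2.2 l)

/-- Every address used in `x` is an integer in `{-k, …, k}`. -/
def HasRangeLE (x : Config q k p) : Prop :=
  ∀ a ∈ x, ∀ l : Fin k, ∃ v : ℤ, a.2.2 l = some v ∧ -(k : ℤ) ≤ v ∧ v ≤ k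

theorem HasRangeLE.of_append_left {x y : Config q k p} (hx : HasRangeLE (x ++ y)) :
    HasRangeLE x := fun a ha => hx a (List.mem_append_left _ ha)

theorem HasRangeLE.of_append_right {x y : Config q k p} (hx : HasRangeLE (x ++ y)) :
    HasRangeLE y := fun a ha => hx a (List.mem_append_right _ ha)

variable (h : Fin p → (Fin k → Option (Fin q)) → ℤ)

theorem energy_eq_sum_siteEnergy (x : Config q k p) :
    energy h x = ∑ j ∈ Finset.range x.length, siteEnergy h x j := by
  rw [Finset.sum_range]
  simp [energy, siteEnergy]

theorem siteEnergy_append_left {x y : Config q k p} (hx : HasRangeLE x) {j : ℕ}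
    (hj : j + k < x.length) : siteEnergy h (x ++ y) j = siteEnergy h x j := by
  have hj' : j < x.length := by omega
  simp only [siteEnergy, List.getElem?_append_left hj', List.getElem?_eq_getElem hj',
    Option.elim_some]
  congr 1
  funext l
  obtain ⟨v, hv, h1, h2⟩ := hx _ (List.getElem_mem hj') l
  simp only [hv, spinAt]
  rw [List.getElem?_append_left (by omega)]

theorem siteEnergy_append_right {x y : Config q k p} (hy : HasRangeLE y) {j : ℕ}
    (hj : k ≤ j) : siteEnergy h (x ++ y) (x.length + j) = siteEnergy h y j := by
  by_cases hj' : j < y.length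
  · simp only [siteEnergy, List.getElem?_append_right (Nat.le_add_right _ _),
      Nat.add_sub_cancel_left, List.getElem?_eq_getElem hj', Option.elim_some]
    congr 1
    funext l
    obtain ⟨v, hv, h1, h2⟩ := hy _ (List.getElem_mem hj') l
    simp only [hv, spinAt]
    rw [if_pos (by omega), if_pos (by omega), List.getElem?_append_right (by omega)]
    congr 2
    push_cast
    omega
  · simp [siteEnergy, hj']

theorem energy_append (x y : Config q k p) :
    energy h (x ++ y) = ∑ j ∈ Finset.range x.length, siteEnergy h (x ++ y) j +
      ∑ j ∈ Finset.range y.length, siteEnergy h (x ++ y) (x.length + j) := by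
  rw [energy_eq_sum_siteEnergy, List.length_append, Finset.sum_range_add]

/-- Appending `z` changes the energy by an amount that depends only on `z` and on the last
`2 * k` sites before it. -/
theorem energy_append_sub_energy {u a b z : Config q k p} (ha : k ≤ a.length) (hb : k ≤ b.length)
    (hx : HasRangeLE (u ++ (a ++ (b ++ z)))) :
    energy h (u ++ (a ++ b) ++ z) - energy h (u ++ (a ++ b)) =
      ∑ j ∈ Finset.range (b ++ z).length, siteEnergy h (a ++ (b ++ z)) (a.length + j) -
      ∑ j ∈ Finset.range b.length, siteEnergy h (a ++ b) (a.length + j) := by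
  have hleft : ∀ j ∈ Finset.range (u ++ a).length,
      siteEnergy h (u ++ a ++ (b ++ z)) j = siteEnergy h (u ++ a ++ b) j := by
    intro j hj
    rw [Finset.mem_range] at hj
    rw [← List.append_assoc _ b z]
    apply siteEnergy_append_left
    · exact HasRangeLE.of_append_left (y := z) (by simpa using hx)
    · rw [List.length_append]; omega
  have hright : ∀ w, HasRangeLE (a ++ w) → ∀ j,
      siteEnergy h (u ++ a ++ w) ((u ++ a).length + j) = siteEnergy h (a ++ w) (a.length + j) := by
    intro w hw j
    rw [List.append_assoc, List.length_append, Nat.add_assoc]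
    exact siteEnergy_append_right h hw (by omega)
  have haz : HasRangeLE (a ++ (b ++ z)) := hx.of_append_right
  have hab : HasRangeLE (a ++ b) := HasRangeLE.of_append_left (y := z) (by simpa using haz)
  rw [show u ++ (a ++ b) ++ z = u ++ a ++ (b ++ z) by simp,
    show u ++ (a ++ b) = u ++ a ++ b by simp, energy_append, energy_append,
    Finset.sum_congr rfl hleft]
  simp only [hright _ haz, hright _ hab]
  ring

theorem energy_append_congr {y y' z : Config q k p} (hy : HasRangeLE (y ++ z))
    (hy' : HasRangeLE (y' ++ z)) (he : energy h y = energy h y')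
    (hs : y.rtake (2 * k) = y'.rtake (2 * k)) : energy h (y ++ z) = energy h (y' ++ z) := by
  have split : ∀ x : Config q k p, x.length < 2 * k ∧ x.rtake (2 * k) = x ∨
      2 * k ≤ x.length ∧ (x.rtake (2 * k)).length = 2 * k ∧
        ∃ u, x = u ++ ((x.rtake (2 * k)).take k ++ (x.rtake (2 * k)).drop k) := by
    intro x
    rcases lt_or_ge x.length (2 * k) with hx | hx
    · exact Or.inl ⟨hx, by simp [List.rtake, Nat.sub_eq_zero_of_le hx.le]⟩
    · refine Or.inr ⟨hx, by simp [List.rtake]; omega, x.take (x.length - 2 * k), ?_⟩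
      simp [List.rtake]
  rcases split y with ⟨h1, h2⟩ | ⟨h1, h2, u, hu⟩ <;>
    rcases split y' with ⟨h1', h2'⟩ | ⟨h1', h2', u', hu'⟩
  · rw [← h2, ← h2', hs]
  · have := congrArg List.length hs
    rw [h2, h2'] at this; omega
  · have := congrArg List.length hs
    rw [h2, h2'] at this; omega
  · rw [← hs] at hu'
    have hla : k ≤ ((y.rtake (2 * k)).take k).length := by rw [List.length_take]; omega
    have hlb : k ≤ ((y.rtake (2 * k)).drop k).length := by rw [List.length_drop]; omega
    generalize (y.rtake (2 * k)).take k = a at *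
    generalize (y.rtake (2 * k)).drop k = b at *
    subst hu hu'
    have e := energy_append_sub_energy h (u := u) (z := z) hla hlb (by simpa using hy)
    have e' := energy_append_sub_energy h (u := u') (z := z) hla hlb (by simpa using hy')
    linarith

end Energy

theorem Is1DIntSet.finite {k p : ℕ} {S : Set (LocInt k p)} (hS : Is1DIntSet S) : S.Finite := by
  refine (Set.finite_univ.prod (Set.Finite.pi' fun _ : Fin k =>
    (Set.finite_Icc (-(k : ℤ)) k).image some)).subset fun I hI => ⟨trivial, fun l => ?_⟩
  obtain ⟨a, ha, h1, h2⟩ := hS.2 I hI l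
  exact ⟨a, ⟨h1, h2⟩, ha.symm⟩

theorem mem_Domain1D {q k p : ℕ} {S : Set (LocInt k p)} {x : Config q k p} :
    x ∈ Domain1D q S ↔ x ≠ [] ∧ ∀ a ∈ x, a.2 ∈ S := by
  simp only [Domain1D, Set.mem_ofPred_eq, List.forall_mem_iff_get]

/-- If `H` is an effectively 0D spin Hamiltonian, then its language
with binary energy encoding `L_H^b` is regular. -/
theorem eff0D_binary_regular {q k p : ℕ} (hq : 0 < q) (hk : 0 < k) (hp : 0 < p)
    (h : Fin p → (Fin k → Option (Fin q)) → ℤ)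
    (S : Set (LocInt k p)) (hS : Is1DIntSet S)
    (hbdd : ∃ B : ℤ, ∀ x ∈ Domain1D q S, |energy h x| ≤ B) :
    (langHB h (Domain1D q S)).IsRegular := by
  obtain ⟨B, hB⟩ := hbdd
  let A : Set (Fin q × LocInt k p) := {a | a.2 ∈ S}
  have hA : A.Finite := (Set.finite_univ.prod hS.finite).subset fun a ha => ⟨trivial, ha⟩
  have hrange : ∀ x : Config q k p, (∀ a ∈ x, a ∈ A) → HasRangeLE x :=
    fun x hx a ha => hS.2 _ (hx a ha)
  have hfin : (energy h '' Domain1D q S).Finite := by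
    refine (Set.finite_Icc (-B) B).subset ?_
    rintro _ ⟨x, hx, rfl⟩
    exact abs_le.1 (hB x hx)
  let tail : ℤ → List (Symb q p) := fun e => Symb.comp :: binEnc e ++ [Symb.bullet]
  have hL : langHB h (Domain1D q S) =
      ({w | ∃ x ∈ Domain1D q S, w = x.flatMap (fun a => Symb.spin a.1 :: encInt a.2) ++
        tail (energy h x)} : Language (Symb q p)) := by
    simp only [langHB, encConfig, tail, List.flatMap_def, List.append_assoc, List.cons_append,
      List.nil_append]
    rfl
  rw [hL]
  refine Language.isRegular_flatMap_append _ hA _ (fun x hx => (mem_Domain1D.1 hx).2)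
    (fun x => tail (energy h x)) ?_
    (fun y => (energy h y, y.rtake (2 * k))) ?_ ?_
  · rw [← Set.image_image tail (energy h)]
    exact hfin.image tail
  · refine ((hfin.insert 0).prod
      (List.finite_setOf_forall_mem_length_le hA (2 * k))).subset ?_
    rintro _ ⟨y, hy, rfl⟩
    refine ⟨?_, fun a ha => hy a (List.mem_of_mem_drop ha), by simp [List.rtake]; omega⟩
    rcases eq_or_ne y [] with rfl | hne
    · exact Or.inl (by simp [energy])
    · exact Or.inr ⟨y, mem_Domain1D.2 ⟨hne, hy⟩, rfl⟩
  · intro y y' z hy hy' hc hyz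
    obtain ⟨he, hs⟩ := Prod.mk.inj hc
    rw [mem_Domain1D] at hyz
    have hz : ∀ a ∈ z, a ∈ A := fun a ha => hyz.2 a (List.mem_append_right _ ha)
    have hyz' : ∀ a ∈ y' ++ z, a ∈ A := fun a ha =>
      (List.mem_append.1 ha).elim (hy' a) (hz a)
    refine ⟨mem_Domain1D.2 ⟨fun h0 => hyz.1 ?_, hyz'⟩, ?_⟩
    · obtain ⟨rfl, rfl⟩ := List.append_eq_nil_iff.1 h0
      have : y.length - 2 * k ≥ y.length := by simpa [List.rtake] using hs
      have : y.length = 0 := by omega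
      simpa using this
    · simp only [energy_append_congr h (hrange _ hyz.2) (hrange _ hyz') he hs]
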